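/- Let Ω be a clustering of a finite set X of N samples and let C be a clustering of X. Suppose two distinct clusters w_1, w_2 ∈ Ω with sizes p = |w_1| ≤ q = |w_2| have a common dominant class c_1 ∈ C, with purities t_1 = |w_1 ∩ c_1|/|w_1| ≥ 0.7 and t_2 = |w_2 ∩ c_1|/|w_2| ≥ 0.7. Let Ω* be obtained from Ω by merging w_1 and w_2, and set Δh = (1/N)·( p·log((p+q)/p) + q·log((p+q)/q) ). Then I(Ω*;C) ≥ I(Ω;C) − 0.0812·p/N − (1 − min{t_1, t_2})·Δh. -/

import Mathlib

open Finset

/-- `Ω` is a clustering (partition into nonempty clusters) of the finite set `X`. -/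
def IsClustering {α : Type*} [DecidableEq α] (X : Finset α) (Ω : Finset (Finset α)) : Prop :=
  (∀ w ∈ Ω, w.Nonempty) ∧
  (∀ w ∈ Ω, ∀ w' ∈ Ω, w ≠ w' → Disjoint w w') ∧
  Ω.biUnion id = X

/-- Entropy of a clustering of `N` samples:  `H(Ω) = -∑ (|w|/N) log (|w|/N)`. -/
noncomputable def clEntropy {α : Type*} (N : ℕ) (Ω : Finset (Finset α)) : ℝ :=
  -∑ w ∈ Ω, ((w.card : ℝ) / N) * Real.log ((w.card : ℝ) / N)

/-- Mutual information between two clusterings of `N` samples (with `0 · log 0 = 0`,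
which holds automatically since `Real.log 0 = 0`). -/
noncomputable def clMI {α : Type*} [DecidableEq α] (N : ℕ) (Ω C : Finset (Finset α)) : ℝ :=
  ∑ w ∈ Ω, ∑ c ∈ C, (((w ∩ c).card : ℝ) / N) *
    Real.log (((N : ℝ) * ((w ∩ c).card : ℝ)) / ((w.card : ℝ) * (c.card : ℝ)))

/-- Normalized mutual information `n(Ω,C) = 2 I(Ω;C) / (H(Ω) + H(C))`. -/
noncomputable def clNMI {α : Type*} [DecidableEq α] (N : ℕ) (Ω C : Finset (Finset α)) : ℝ :=
  2 * clMI N Ω C / (clEntropy N Ω + clEntropy N C)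

/-- The clustering obtained from `Ω` by replacing `w₁` and `w₂` with `w₁ ∪ w₂`. -/
def mergeClusters {α : Type*} [DecidableEq α] (Ω : Finset (Finset α)) (w₁ w₂ : Finset α) :
    Finset (Finset α) :=
  insert (w₁ ∪ w₂) ((Ω.erase w₁).erase w₂)

/-- Monotonicity of the merged entropy function, via the Gibbs inequality. -/
lemma merge_gibbs (a b a0 b0 : ℝ) (ha0 : 0 < a0) (hb0 : 0 < b0) (ha : a0 ≤ a) (hb : b0 ≤ b) :
    a0 * Real.log ((a0 + b0) / a0) + b0 * Real.log ((a0 + b0) / b0) ≤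
      a * Real.log ((a + b) / a) + b * Real.log ((a + b) / b) := by
  have hap : 0 < a := by linarith
  have hbp : 0 < b := by linarith
  have h1 : 0 ≤ Real.log ((a + b) / a) :=
    Real.log_nonneg (by rw [le_div_iff₀ hap]; linarith)
  have h2 : 0 ≤ Real.log ((a + b) / b) :=
    Real.log_nonneg (by rw [le_div_iff₀ hbp]; linarith)
  have key : ∀ u v : ℝ, 0 < u → 0 < v → u * Real.log ((a0 + b0) / u)
      - u * Real.log ((a + b) / v) ≤ v / (a + b) * (a0 + b0) - u := by
    intro u v hu hv
    have hs : 0 < a + b := by linarith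
    have hs0 : 0 < a0 + b0 := by linarith
    rw [← mul_sub, ← Real.log_div (by positivity) (by positivity)]
    have := Real.log_le_sub_one_of_pos (x := (a0 + b0) / u / ((a + b) / v)) (by positivity)
    calc _ ≤ u * ((a0 + b0) / u / ((a + b) / v) - 1) := by gcongr
      _ = _ := by field_simp
  have k1 := key a0 a ha0 hap
  have k2 := key b0 b hb0 hbp
  have k3 : a / (a + b) * (a0 + b0) + b / (a + b) * (a0 + b0) = a0 + b0 := by
    have hs : a + b ≠ 0 := by linarith
    field_simp
  nlinarith [mul_nonneg (sub_nonneg.2 ha) h1, mul_nonneg (sub_nonneg.2 hb) h2]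

/-- The single-class change of mutual information. -/
lemma merge_term (N p q c a b : ℝ) (hN : 0 < N) (hp : 0 < p) (hq : 0 < q) (hc : 0 < c)
    (ha : 0 ≤ a) (hb : 0 ≤ b) :
    (a + b) / N * Real.log (N * (a + b) / ((p + q) * c)) =
      a / N * Real.log (N * a / (p * c)) + b / N * Real.log (N * b / (q * c))
      - (1 / N) * (a * Real.log ((p + q) / p) + b * Real.log ((p + q) / q))
      + (1 / N) * (a * Real.log ((a + b) / a) + b * Real.log ((a + b) / b)) := by
  have key : ∀ u v : ℝ, 0 ≤ u → u ≤ a + b → 0 < v →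
      u / N * Real.log (N * (a + b) / ((p + q) * c)) =
        u / N * Real.log (N * u / (v * c)) - (1 / N) * (u * Real.log ((p + q) / v))
        + (1 / N) * (u * Real.log ((a + b) / u)) := by
    intro u v hu huv hv
    rcases hu.eq_or_lt with rfl | hu
    · simp
    have hs : 0 < a + b := by linarith
    have hpq : 0 < p + q := by linarith
    rw [Real.log_div (by positivity) (by positivity), Real.log_div (by positivity) (by positivity),
      Real.log_div (by positivity) (by positivity), Real.log_div (by positivity) (by positivity),
      Real.log_mul (by positivity) (by positivity), Real.log_mul (by positivity) (by positivity),
      Real.log_mul (by positivity) (by positivity), Real.log_mul (by positivity) (by positivity)]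
    ring
  have k1 := key a p ha (by linarith) hp
  have k2 := key b q hb (by linarith) hq
  rw [add_div, add_mul, k1, k2]
  ring

lemma merge_term_nonneg (a b : ℝ) (ha : 0 ≤ a) (hb : 0 ≤ b) :
    0 ≤ a * Real.log ((a + b) / a) + b * Real.log ((a + b) / b) := by
  have key : ∀ u : ℝ, 0 ≤ u → u ≤ a + b → 0 ≤ u * Real.log ((a + b) / u) := by
    intro u hu huv
    rcases hu.eq_or_lt with rfl | hu
    · simp
    exact mul_nonneg hu.le (Real.log_nonneg (by rw [le_div_iff₀ hu]; linarith))
  exact add_nonneg (key a ha (by linarith)) (key b hb (by linarith))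

lemma clustering_sum_card {α : Type*} [DecidableEq α] (X : Finset α) (C : Finset (Finset α))
    (hC : IsClustering X C) (w : Finset α) (hw : w ⊆ X) :
    ∑ c ∈ C, ((w ∩ c).card : ℝ) = (w.card : ℝ) := by
  obtain ⟨-, hd, hu⟩ := hC
  have : w = C.biUnion (fun c => w ∩ c) := by
    have h : C.biUnion (fun c => w ∩ c) = w ∩ C.biUnion id := by
      rw [Finset.inter_biUnion]; rfl
    rw [h, hu, Finset.inter_eq_left.2 hw]
  conv_rhs => rw [this]
  rw [Finset.card_biUnion]
  · push_cast; rfl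
  · intro x hx y hy hxy
    exact (hd x hx y hy hxy).mono Finset.inter_subset_right Finset.inter_subset_right

/-- Lower bound on the mutual information after merging two pure clusters (Eq. (24) in the
paper): `I(Ω*;C) ≥ I(Ω;C) - 0.0812 p / N - (1 - min t₁ t₂) Δh`. -/
theorem mutualInformation_merge_lowerBound' {α : Type*} [DecidableEq α]
    (X : Finset α) (N : ℕ) (hN : X.card = N)
    (Ω C : Finset (Finset α)) (hΩ : IsClustering X Ω) (hC : IsClustering X C)
    (w₁ w₂ : Finset α) (hw₁ : w₁ ∈ Ω) (hw₂ : w₂ ∈ Ω) (hne : w₁ ≠ w₂)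
    (c₁ : Finset α) (hc₁ : c₁ ∈ C)
    (hdom₁ : ∀ c ∈ C, (w₁ ∩ c).card ≤ (w₁ ∩ c₁).card)
    (hdom₂ : ∀ c ∈ C, (w₂ ∩ c).card ≤ (w₂ ∩ c₁).card)
    (p q : ℝ) (hp : p = (w₁.card : ℝ)) (hq : q = (w₂.card : ℝ)) (hpq : p ≤ q)
    (t₁ t₂ : ℝ)
    (ht₁ : t₁ = ((w₁ ∩ c₁).card : ℝ) / (w₁.card : ℝ))
    (ht₂ : t₂ = ((w₂ ∩ c₁).card : ℝ) / (w₂.card : ℝ))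
    (ht₁7 : (0.7 : ℝ) ≤ t₁) (ht₂7 : (0.7 : ℝ) ≤ t₂)
    (Δh : ℝ)
    (hΔh : Δh = (1 / (N : ℝ)) *
      (p * Real.log ((p + q) / p) + q * Real.log ((p + q) / q))) :
    clMI N (mergeClusters Ω w₁ w₂) C ≥
      clMI N Ω C - (0.0812 : ℝ) * p / N - (1 - min t₁ t₂) * Δh := by
  obtain ⟨hΩne, hΩd, hΩu⟩ := id hΩ
  have hd : Disjoint w₁ w₂ := hΩd _ hw₁ _ hw₂ hne
  have hs₁ : w₁ ⊆ X := hΩu ▸ Finset.subset_biUnion_of_mem id hw₁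
  have hs₂ : w₂ ⊆ X := hΩu ▸ Finset.subset_biUnion_of_mem id hw₂
  have hp0 : 0 < p := by rw [hp]; exact_mod_cast (hΩne _ hw₁).card_pos
  have hq0 : 0 < q := by rw [hq]; exact_mod_cast (hΩne _ hw₂).card_pos
  have hN0 : (0 : ℝ) < N := by
    rw [← hN]; exact_mod_cast ((hΩne _ hw₁).mono hs₁).card_pos
  have hnot : w₁ ∪ w₂ ∉ (Ω.erase w₁).erase w₂ := by
    intro h
    simp only [Finset.mem_erase] at h
    have h1 := hΩd _ h.2.2 _ hw₁ h.2.1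
    obtain ⟨x, hx⟩ := hΩne _ hw₁
    exact Finset.disjoint_left.1 h1 (Finset.mem_union_left _ hx) hx
  have hw₂' : w₂ ∈ Ω.erase w₁ := Finset.mem_erase.2 ⟨hne.symm, hw₂⟩
  set H : Finset α → ℝ := fun c =>
    ((w₁ ∩ c).card : ℝ) * Real.log ((((w₁ ∩ c).card : ℝ) + ((w₂ ∩ c).card : ℝ)) / ((w₁ ∩ c).card : ℝ))
    + ((w₂ ∩ c).card : ℝ) * Real.log ((((w₁ ∩ c).card : ℝ) + ((w₂ ∩ c).card : ℝ)) / ((w₂ ∩ c).card : ℝ))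
    with hH
  have hmerge : clMI N (mergeClusters Ω w₁ w₂) C = clMI N Ω C - Δh + (1 / (N : ℝ)) * ∑ c ∈ C, H c := by
    unfold clMI mergeClusters
    rw [Finset.sum_insert hnot, ← Finset.add_sum_erase Ω _ hw₁,
      ← Finset.add_sum_erase (Ω.erase w₁) _ hw₂']
    have hterm : ∑ c ∈ C, ((((w₁ ∪ w₂) ∩ c).card : ℝ) / N) *
        Real.log (((N : ℝ) * (((w₁ ∪ w₂) ∩ c).card : ℝ)) / (((w₁ ∪ w₂).card : ℝ) * (c.card : ℝ))) =
        ∑ c ∈ C, ((((w₁ ∩ c).card : ℝ) / N) *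
          Real.log (((N : ℝ) * ((w₁ ∩ c).card : ℝ)) / ((w₁.card : ℝ) * (c.card : ℝ)))
        + (((w₂ ∩ c).card : ℝ) / N) *
          Real.log (((N : ℝ) * ((w₂ ∩ c).card : ℝ)) / ((w₂.card : ℝ) * (c.card : ℝ)))
        - (1 / (N : ℝ)) * (((w₁ ∩ c).card : ℝ) * Real.log ((p + q) / p)
          + ((w₂ ∩ c).card : ℝ) * Real.log ((p + q) / q))
        + (1 / (N : ℝ)) * H c) := by
      refine Finset.sum_congr rfl fun c hc => ?_
      have hc0 : (0 : ℝ) < c.card := by exact_mod_cast (hC.1 c hc).card_pos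
      have e1 : (((w₁ ∪ w₂) ∩ c).card : ℝ) = ((w₁ ∩ c).card : ℝ) + ((w₂ ∩ c).card : ℝ) := by
        rw [Finset.union_inter_distrib_right, Finset.card_union_of_disjoint
          (hd.mono Finset.inter_subset_left Finset.inter_subset_left)]
        push_cast; rfl
      have e2 : ((w₁ ∪ w₂).card : ℝ) = p + q := by
        rw [Finset.card_union_of_disjoint hd, hp, hq]; push_cast; rfl
      rw [e1, e2, ← hp, ← hq]
      exact merge_term N p q c.card _ _ hN0 hp0 hq0 hc0 (by positivity) (by positivity)
    rw [hterm, Finset.sum_add_distrib, Finset.sum_sub_distrib, Finset.sum_add_distrib,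
      ← Finset.mul_sum, ← Finset.mul_sum, Finset.sum_add_distrib, ← Finset.sum_mul,
      ← Finset.sum_mul, clustering_sum_card X C hC w₁ hs₁, clustering_sum_card X C hC w₂ hs₂,
      ← hp, ← hq, ← hΔh]
    ring
  have hHc : H c₁ ≤ ∑ c ∈ C, H c :=
    Finset.single_le_sum (f := H)
      (fun c _ => merge_term_nonneg _ _ (by positivity) (by positivity)) hc₁
  have hm0 : 0 < min t₁ t₂ := lt_min (by norm_num at ht₁7; linarith) (by norm_num at ht₂7; linarith)
  have ea : ((w₁ ∩ c₁).card : ℝ) = t₁ * p := by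
    rw [ht₁, ← hp]; field_simp
  have eb : ((w₂ ∩ c₁).card : ℝ) = t₂ * q := by
    rw [ht₂, ← hq, div_mul_cancel₀ _ hq0.ne']
  have hg := merge_gibbs (t₁ * p) (t₂ * q) (min t₁ t₂ * p) (min t₁ t₂ * q)
    (by positivity) (by positivity)
    (mul_le_mul_of_nonneg_right (min_le_left _ _) hp0.le)
    (mul_le_mul_of_nonneg_right (min_le_right _ _) hq0.le)
  rw [← mul_add (min t₁ t₂), mul_div_mul_left _ _ hm0.ne', mul_div_mul_left _ _ hm0.ne'] at hg
  have hH1 : min t₁ t₂ * Δh ≤ (1 / (N : ℝ)) * ∑ c ∈ C, H c := by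
    calc min t₁ t₂ * Δh = (1 / (N : ℝ)) * (min t₁ t₂ * p * Real.log ((p + q) / p)
          + min t₁ t₂ * q * Real.log ((p + q) / q)) := by rw [hΔh]; ring
      _ ≤ (1 / (N : ℝ)) * H c₁ := by
          apply mul_le_mul_of_nonneg_left _ (by positivity)
          simp only [hH, ea, eb]
          exact hg
      _ ≤ _ := by gcongr
  have hpN : 0 ≤ (0.0812 : ℝ) * p / N := by positivity
  rw [hmerge]
  linarith
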